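/- Let V be a d×d real orthogonal matrix, 1 ≤ k < d, θ > 1, π a permutation of {1,…,d} with ℓ_{π(1)} ≥ … ≥ ℓ_{π(d)}, and q with k ≤ q ≤ d such that ∑_{i=1}^q ℓ_{π(i)} ≥ k − 1 + 1/θ; set Q = {π(1),…,π(q)}. Then ∑_{S⊆Q, |S|=k, det(V_{S,[k]})≠0} det(V_{S,[k]})² · Tr(Z_S Z_Sᵀ) ≤ ((q−k+1)(k−1+θ) − k) · ∑_{S⊆Q, |S|=k} det(V_{S,[k]})²; in particular the conditional DPP expectation of ∑_i tan²θ_i(S) given S ⊆ Q is at most (q−k+1)(k−1+θ). -/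

import Mathlib

open Matrix

/-- The increasing enumeration of a size-`k` subset of `Fin d`. -/
def rowEnum {d k : ℕ} (S : {S : Finset (Fin d) // S.card = k}) : Fin k → Fin d :=
  fun i => ((S.1.orderIsoOfFin S.2) i).1

/-- `V_{S,[k]}`: the `k×k` submatrix of `V` with rows indexed by `S` and columns `1,…,k`. -/
noncomputable def Vlow {d : ℕ} (V : Matrix (Fin d) (Fin d) ℝ) {k : ℕ} (hkd : k ≤ d)
    (S : {S : Finset (Fin d) // S.card = k}) : Matrix (Fin k) (Fin k) ℝ :=
  V.submatrix (rowEnum S) (Fin.castLE hkd)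

/-- `V_{S,[k+1:d]}`: the `k×(d-k)` submatrix of `V` with rows indexed by `S` and columns
`k+1,…,d`. -/
noncomputable def Vhigh {d : ℕ} (V : Matrix (Fin d) (Fin d) ℝ) {k : ℕ} (hkd : k ≤ d)
    (S : {S : Finset (Fin d) // S.card = k}) : Matrix (Fin k) (Fin (d - k)) ℝ :=
  V.submatrix (rowEnum S) (fun j : Fin (d - k) => (⟨k + (j : ℕ), by have := j.isLt; omega⟩ : Fin d))

/-- `Z_S = (V_{S,[k+1:d]})ᵀ · ((V_{S,[k]})ᵀ)⁻¹ ∈ ℝ^{(d-k)×k}` whose squared Frobenius norm is the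
sum of the squared tangents of the principal angles between `span{e_i : i ∈ S}` and the span of
the first `k` columns of `V`. -/
noncomputable def ZS {d : ℕ} (V : Matrix (Fin d) (Fin d) ℝ) {k : ℕ} (hkd : k ≤ d)
    (S : {S : Finset (Fin d) // S.card = k}) : Matrix (Fin (d - k)) (Fin k) ℝ :=
  (Vhigh V hkd S)ᵀ * ((Vlow V hkd S)ᵀ)⁻¹

/-- The `k`-leverage score of row `i`: `ℓ_i = ∑_{j=1}^k V_{i,j}²`. -/
noncomputable def lev {d : ℕ} (V : Matrix (Fin d) (Fin d) ℝ) (k : ℕ) (hkd : k ≤ d)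
    (i : Fin d) : ℝ :=
  ∑ j : Fin k, V i (Fin.castLE hkd j) ^ 2

theorem Matrix.det_sq_eq_sum_perm {R κ : Type*} [CommRing R] [Fintype κ] [DecidableEq κ]
    (N : Matrix κ κ R) :
    N.det ^ 2 = ∑ σ : Equiv.Perm κ, (of fun a b => N (σ a) a * N (σ a) b).det := by
  have key : ∀ σ : Equiv.Perm κ, (of fun a b => N (σ a) a * N (σ a) b).det =
      (Equiv.Perm.sign σ • ∏ a, N (σ a) a) * N.det := fun σ => by
    have := det_mul_column (fun a => N (σ a) a) (N.submatrix σ id)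
    simp only [submatrix_apply, id] at this
    rw [this, det_permute, Units.smul_def, zsmul_eq_mul]
    ring
  simp_rw [key]
  rw [← Finset.sum_mul, ← det_apply, sq]

/-- A mixed-discriminant form of the Cauchy–Binet formula: row `i` ranges over the family `v i`. -/
theorem Matrix.sum_det_sq_eq_sum_perm {R α κ : Type*} [CommRing R] [Fintype α] [Fintype κ]
    [DecidableEq κ] (v : κ → α → κ → R) :
    ∑ f : κ → α, (of fun i => v i (f i)).det ^ 2 =
      ∑ σ : Equiv.Perm κ, (of fun a b => ∑ x, v (σ a) x a * v (σ a) x b).det := by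
  classical
  simp_rw [det_sq_eq_sum_perm]
  rw [Finset.sum_comm]
  refine Finset.sum_congr rfl fun σ _ => ?_
  have h := (detRowAlternating : (κ → R) [⋀^κ]→ₗ[R] R).toMultilinearMap.map_sum
    (fun a x b => v (σ a) x a * v (σ a) x b)
  have e : (of fun a b => ∑ x, v (σ a) x a * v (σ a) x b : Matrix κ κ R) =
      fun a => ∑ x, fun b => v (σ a) x a * v (σ a) x b := by
    ext a b
    simp
  rw [e]
  refine Eq.trans ?_ h.symm
  exact Fintype.sum_equiv (σ.symm.arrowCongr (Equiv.refl α)) _ _ fun f => by simp; rfl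

/-- The Cauchy–Binet formula for a Gram matrix, summed over all maps choosing the rows. -/
theorem Matrix.sum_det_submatrix_sq {R α κ : Type*} [CommRing R] [Fintype α] [Fintype κ]
    [DecidableEq κ] (A : Matrix α κ R) :
    ∑ f : κ → α, (A.submatrix f id).det ^ 2 = (Fintype.card κ).factorial * (Aᵀ * A).det := by
  have h := sum_det_sq_eq_sum_perm (fun _ : κ => (A : α → κ → R))
  have e : (of fun a b => ∑ x, A x a * A x b : Matrix κ κ R) = Aᵀ * A := by
    ext a b
    simp [mul_apply]
  rw [e, Finset.sum_const, Finset.card_univ, Fintype.card_perm, nsmul_eq_mul] at h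
  exact h

theorem Matrix.sum_sum_adjugate_submatrix_sq {R α κ : Type*} [CommRing R] [Fintype α] [Fintype κ]
    [DecidableEq κ] (A : Matrix α κ R) (j : κ) :
    ∑ i, ∑ f : κ → α, (A.submatrix f id).adjugate j i ^ 2 =
      Fintype.card α * ((Fintype.card κ).factorial * (Aᵀ * A).adjugate j j) := by
  have h : ∀ i, ∑ f : κ → α, (A.submatrix f id).adjugate j i ^ 2 =
      ∑ σ : Equiv.Perm κ,
        if σ.symm i = j then Fintype.card α * (Aᵀ * A).adjugate j j else 0 := fun i => by
    have h := sum_det_sq_eq_sum_perm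
      (fun i' x => if i' = i then (Pi.single j 1 : κ → R) else A x)
    have e : ∀ f : κ → α, (of fun i' => if i' = i then (Pi.single j 1 : κ → R) else A (f i')) =
        (A.submatrix f id).updateRow i (Pi.single j 1) := fun f => by
      ext a b
      by_cases ha : a = i <;> simp [updateRow_apply, ha]
    simp_rw [e, ← adjugate_apply] at h
    rw [h]
    refine Finset.sum_congr rfl fun σ _ => ?_
    split_ifs with hσ
    · rw [adjugate_apply, ← det_updateRow_smul]
      congr 1
      ext a b
      have ha : σ a = i ↔ a = j := by rw [← hσ, Equiv.eq_symm_apply]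
      by_cases h' : a = j
      · subst h'
        simp [ha.2 rfl]
      · simp [ha, h', updateRow_apply, mul_apply]
    · refine det_eq_zero_of_row_eq_zero (σ.symm i) fun b => ?_
      simp [Pi.single_apply, hσ]
  simp_rw [h]
  rw [Finset.sum_comm]
  have : ∀ σ : Equiv.Perm κ, ∑ i, (if σ.symm i = j then
      (Fintype.card α * (Aᵀ * A).adjugate j j : R) else 0) =
        Fintype.card α * (Aᵀ * A).adjugate j j := fun σ => by
    simp [Equiv.symm_apply_eq]
  simp_rw [this]
  rw [Finset.sum_const, Finset.card_univ, Fintype.card_perm, nsmul_eq_mul]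
  ring

open Classical in
theorem card_mul_sum_injective {R α κ : Type*} [CommRing R] [Fintype α] [Fintype κ]
    [DecidableEq κ] (i : κ) (H : (κ → α) → R) (h : Fintype.card κ ≤ Fintype.card α)
    (hH : ∀ f g : κ → α, (∀ j, j ≠ i → f j = g j) → H f = H g)
    (h0 : ∀ (f : κ → α) (a b : κ), a ≠ i → b ≠ i → a ≠ b → f a = f b → H f = 0) :
    (Fintype.card α : R) * ∑ f : κ → α with Function.Injective f, H f =
      (Fintype.card α - Fintype.card κ + 1 : R) * ∑ f, H f := by
  have hα : Nonempty α := Fintype.card_pos_iff.1 ((Fintype.card_pos_iff.2 ⟨i⟩).trans_le h)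
  obtain ⟨x₀⟩ := hα
  set e := (Equiv.funSplitAt i α).symm with he
  have e_i : ∀ x g, e (x, g) i = x := fun x g => by simp [he, Equiv.funSplitAt, Equiv.piSplitAt]
  have e_ne : ∀ x g j (hj : j ≠ i), e (x, g) j = g ⟨j, hj⟩ := fun x g j hj => by
    simp [he, Equiv.funSplitAt, Equiv.piSplitAt, hj]
  have e_H : ∀ x g, H (e (x, g)) = H (e (x₀, g)) := fun x g =>
    hH _ _ fun j hj => by rw [e_ne _ _ _ hj, e_ne _ _ _ hj]
  have count : ∀ g, Function.Injective g →
      ((Finset.univ.filter fun x => Function.Injective (e (x, g))).card : R) =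
        Fintype.card α - Fintype.card κ + 1 := fun g hg => by
    have : (Finset.univ.filter fun x => Function.Injective (e (x, g))) =
        (Finset.univ.image g)ᶜ := by
      ext x
      simp only [Finset.mem_filter, Finset.mem_univ, true_and, Finset.mem_compl, Finset.mem_image,
        not_exists]
      constructor
      · rintro hx ⟨j, hj⟩ hjx
        refine hj (hx ?_)
        rw [e_ne _ _ _ hj, e_i, hjx]
      · intro hx a b hab
        by_cases ha : a = i <;> by_cases hb : b = i
        · rw [ha, hb]
        · subst ha
          rw [e_i, e_ne _ _ _ hb] at hab
          exact absurd hab.symm (hx _)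
        · subst hb
          rw [e_i, e_ne _ _ _ ha] at hab
          exact absurd hab (hx _)
        · rw [e_ne _ _ _ ha, e_ne _ _ _ hb] at hab
          exact congrArg Subtype.val (hg hab)
    have hc : Fintype.card {j // j ≠ i} + 1 = Fintype.card κ := by
      rw [Fintype.card_subtype_compl, Fintype.card_subtype_eq]
      exact Nat.sub_add_cancel (Fintype.card_pos_iff.2 ⟨i⟩)
    rw [this, Finset.card_compl, Finset.card_image_of_injective _ hg, Finset.card_univ,
      Nat.cast_sub (by omega), ← hc]
    push_cast
    ring
  have lhs : ∑ f : κ → α with Function.Injective f, H f =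
      (Fintype.card α - Fintype.card κ + 1 : R) * ∑ g, H (e (x₀, g)) := by
    rw [Finset.sum_filter, ← e.sum_comp, Fintype.sum_prod_type_right, Finset.mul_sum]
    refine Finset.sum_congr rfl fun g _ => ?_
    simp_rw [e_H]
    rw [← Finset.sum_filter, Finset.sum_const, nsmul_eq_mul]
    by_cases hg : Function.Injective g
    · rw [count g hg]
    · have : H (e (x₀, g)) = 0 := by
        simp only [Function.Injective, not_forall] at hg
        obtain ⟨a, b, hab, hne⟩ := hg
        refine h0 _ a b a.2 b.2 (fun h => hne (Subtype.ext h)) ?_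
        rw [e_ne _ _ _ a.2, e_ne _ _ _ b.2, hab]
      simp [this]
  have rhs : ∑ f, H f = Fintype.card α * ∑ g, H (e (x₀, g)) := by
    rw [← e.sum_comp, Fintype.sum_prod_type_right, Finset.mul_sum]
    refine Finset.sum_congr rfl fun g _ => ?_
    simp_rw [e_H]
    rw [Finset.sum_const, Finset.card_univ, nsmul_eq_mul]
  rw [lhs, rhs]
  ring

open Classical in
theorem Matrix.sum_injective_adjugate_sq {R α κ : Type*} [CommRing R] [IsDomain R] [CharZero R]
    [Fintype α] [Fintype κ] [DecidableEq κ] [Nonempty κ] (A : Matrix α κ R)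
    (h : Fintype.card κ ≤ Fintype.card α) :
    ∑ f : κ → α with Function.Injective f, ∑ j, ∑ i, (A.submatrix f id).adjugate j i ^ 2 =
      (Fintype.card κ).factorial *
        ((Fintype.card α - Fintype.card κ + 1 : R) * (Aᵀ * A).adjugate.trace) := by
  have hα : (Fintype.card α : R) ≠ 0 :=
    Nat.cast_ne_zero.2 (Fintype.card_pos.trans_le h).ne'
  have h1 : ∀ j i : κ, (Fintype.card α : R) *
      ∑ f : κ → α with Function.Injective f, (A.submatrix f id).adjugate j i ^ 2 =
      (Fintype.card α - Fintype.card κ + 1 : R) *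
        ∑ f : κ → α, (A.submatrix f id).adjugate j i ^ 2 := fun j i => by
    refine card_mul_sum_injective i _ h (fun f g hfg => ?_) fun f a b ha hb hab hf => ?_
    · simp only [adjugate_apply]
      congr 2
      ext a b
      by_cases ha : a = i
      · simp [updateRow_apply, ha]
      · simp [updateRow_apply, ha, hfg]
    · rw [adjugate_apply, det_zero_of_row_eq hab, zero_pow two_ne_zero]
      ext c
      simp [updateRow_apply, ha, hb, hf]
  refine mul_left_cancel₀ hα ?_
  rw [Finset.sum_comm, Finset.mul_sum]
  have h2 : ∀ j : κ, (Fintype.card α : R) * ∑ f : κ → α with Function.Injective f,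
      ∑ i, (A.submatrix f id).adjugate j i ^ 2 =
      (Fintype.card α - Fintype.card κ + 1 : R) *
        (Fintype.card α * ((Fintype.card κ).factorial * (Aᵀ * A).adjugate j j)) := fun j => by
    rw [← sum_sum_adjugate_submatrix_sq, Finset.sum_comm, Finset.mul_sum, Finset.mul_sum]
    exact Finset.sum_congr rfl fun i _ => h1 j i
  simp_rw [h2, trace, diag_apply]
  simp_rw [← Finset.mul_sum]
  ring

open Classical in
theorem Matrix.sum_injective_det_sq {R α κ : Type*} [CommRing R]
    [Fintype α] [Fintype κ] [DecidableEq κ] (A : Matrix α κ R) :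
    ∑ f : κ → α with Function.Injective f, (A.submatrix f id).det ^ 2 =
      (Fintype.card κ).factorial * (Aᵀ * A).det := by
  rw [← sum_det_submatrix_sq, Finset.sum_filter]
  refine Finset.sum_congr rfl fun f _ => ?_
  split_ifs with hf
  · rfl
  · simp only [Function.Injective, not_forall] at hf
    obtain ⟨a, b, hab, hne⟩ := hf
    rw [det_zero_of_row_eq (M := A.submatrix f id) hne, zero_pow two_ne_zero]
    ext c
    simp [hab]

theorem Matrix.trace_adjugate_le {κ : Type*} [Fintype κ] [DecidableEq κ]
    {M : Matrix κ κ ℝ} (hM : M.PosSemidef) (hM1 : (1 - M).PosSemidef) {θ : ℝ} (hθ : 0 < θ)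
    (htr : Fintype.card κ - 1 + 1 / θ ≤ M.trace) :
    M.adjugate.trace ≤ (Fintype.card κ - 1 + θ) * M.det := by
  have hH := hM.isHermitian
  set l := hH.eigenvalues
  set U : Matrix κ κ ℝ := hH.eigenvectorUnitary.1
  have hUU : star U * U = 1 := Unitary.coe_star_mul_self hH.eigenvectorUnitary
  have hspec : M = U * diagonal l * star U := by
    have := hH.spectral_theorem
    rw [Unitary.conjStarAlgAut_apply] at this
    exact this
  have l0 : ∀ i, 0 ≤ l i := hM.eigenvalues_nonneg
  have l1 : ∀ i, l i ≤ 1 := fun i => by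
    have h := (hM1.conjTranspose_mul_mul_same U).diag_nonneg (i := i)
    have e : Uᴴ * (1 - M) * U = 1 - diagonal l := by
      rw [← star_eq_conjTranspose, hspec, mul_sub, sub_mul, mul_one, hUU]
      congr 1
      calc star U * (U * diagonal l * star U) * U
          = (star U * U) * diagonal l * (star U * U) := by simp only [mul_assoc]
        _ = diagonal l := by rw [hUU, one_mul, mul_one]
    rw [e] at h
    simpa using h
  have htrl : M.trace = ∑ i, l i := by
    rw [hspec, trace_mul_comm, ← mul_assoc, hUU, one_mul, trace_diagonal]
  have hadj : M.adjugate.trace = ∑ i, ∏ j ∈ Finset.univ.erase i, l j := by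
    rw [hspec, adjugate_mul_distrib, adjugate_mul_distrib, trace_mul_comm, mul_assoc,
      ← adjugate_mul_distrib, hUU, adjugate_one, mul_one, adjugate_diagonal, trace_diagonal]
  have hdet : M.det = ∏ i, l i := by
    rw [hH.det_eq_prod_eigenvalues]; rfl
  have lθ : ∀ i, 1 / θ ≤ l i := fun i => by
    have h2 : ∑ j ∈ Finset.univ.erase i, l j ≤ Fintype.card κ - 1 := by
      refine (Finset.sum_le_card_nsmul _ _ 1 fun j _ => l1 j).trans ?_
      rw [Finset.card_erase_of_mem (Finset.mem_univ i), Finset.card_univ, nsmul_eq_mul, mul_one,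
        Nat.cast_sub (Fintype.card_pos_iff.2 ⟨i⟩)]
      simp
    have := Finset.add_sum_erase Finset.univ l (Finset.mem_univ i)
    linarith
  have chord : ∀ i, ∏ j ∈ Finset.univ.erase i, l j ≤ (1 + θ * (1 - l i)) * ∏ j, l j := fun i => by
    rw [← Finset.mul_prod_erase Finset.univ l (Finset.mem_univ i), ← mul_assoc]
    refine le_mul_of_one_le_left (Finset.prod_nonneg fun j _ => l0 j) ?_
    have h := (div_le_iff₀ hθ).1 (lθ i)
    nlinarith [mul_nonneg (sub_nonneg.2 h) (sub_nonneg.2 (l1 i))]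
  rw [hadj, hdet]
  refine (Finset.sum_le_sum fun i _ => chord i).trans ?_
  rw [← Finset.sum_mul]
  refine mul_le_mul_of_nonneg_right ?_ (Finset.prod_nonneg fun j _ => l0 j)
  rw [Finset.sum_add_distrib, ← Finset.mul_sum, Finset.sum_sub_distrib]
  simp only [Finset.sum_const, Finset.card_univ, nsmul_eq_mul, mul_one]
  rw [htrl] at htr
  have := mul_le_mul_of_nonneg_left htr hθ.le
  rw [mul_add, mul_one_div_cancel hθ.ne'] at this
  linarith

open Classical in
theorem sum_injective_eq_factorial_mul_sum {R : Type*} [Semiring R] {d k : ℕ} (Q : Finset (Fin d))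
    (F : (Fin k → Fin d) → R) (hF : ∀ f (σ : Equiv.Perm (Fin k)), F (f ∘ σ) = F f) :
    ∑ f : Fin k → Q with Function.Injective f, F (fun i => f i) =
      k.factorial * ∑ S : {S : Finset (Fin d) // S.card = k} with S.1 ⊆ Q, F (rowEnum S) := by
  have hinj : ∀ S : {S : Finset (Fin d) // S.card = k}, Function.Injective (rowEnum S) :=
    fun S => Subtype.val_injective.comp (S.1.orderIsoOfFin S.2).injective
  have hmem : ∀ (S : {S : Finset (Fin d) // S.card = k}) i, rowEnum S i ∈ S.1 :=
    fun S i => ((S.1.orderIsoOfFin S.2) i).2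
  have himage : ∀ (S : {S : Finset (Fin d) // S.card = k}) (σ : Equiv.Perm (Fin k)),
      Finset.univ.image (fun i => rowEnum S (σ i)) = S.1 := fun S σ => by
    refine Finset.eq_of_subset_of_card_le ?_ ?_
    · exact Finset.image_subset_iff.2 fun i _ => hmem S _
    · rw [Finset.card_image_of_injective (f := fun i => rowEnum S (σ i)) _ ((hinj S).comp σ.injective), Finset.card_univ,
        Fintype.card_fin, S.2]
  have h1 : (k.factorial : R) * ∑ S : {S : Finset (Fin d) // S.card = k} with S.1 ⊆ Q,
      F (rowEnum S) = ∑ S : {S : Finset (Fin d) // S.card = k} with S.1 ⊆ Q,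
        ∑ σ : Equiv.Perm (Fin k), F (rowEnum S ∘ σ) := by
    simp_rw [hF]
    rw [Finset.mul_sum]
    simp [Fintype.card_perm]
  rw [h1, ← Finset.sum_product']
  symm
  refine Finset.sum_bij
    (fun p hp i => ⟨rowEnum p.1 (p.2 i),
      (Finset.mem_filter.1 (Finset.mem_product.1 hp).1).2 (hmem p.1 _)⟩) ?_ ?_ ?_ ?_
  · rintro ⟨S, σ⟩ hp
    refine Finset.mem_filter.2 ⟨Finset.mem_univ _, fun a b hab => ?_⟩
    have hab' : rowEnum S (σ a) = rowEnum S (σ b) :=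
      congrArg (fun x : Q => (x : Fin d)) hab
    exact σ.injective (hinj S hab')
  · rintro ⟨S, σ⟩ hp ⟨T, τ⟩ hq h
    have h' : ∀ i, rowEnum S (σ i) = rowEnum T (τ i) :=
      fun i => congrArg Subtype.val (congrFun h i)
    have hST : S = T := by
      refine Subtype.ext ?_
      rw [← himage S σ, ← himage T τ]
      exact congrArg (fun f => Finset.univ.image f) (funext h')
    subst hST
    have : σ = τ := Equiv.ext fun i => hinj S (h' i)
    rw [this]
  · intro f hf
    have hf' : Function.Injective fun i => (f i).1 :=
      Subtype.val_injective.comp (Finset.mem_filter.1 hf).2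
    let S : {S : Finset (Fin d) // S.card = k} :=
      ⟨Finset.univ.image fun i => (f i).1, by
        rw [Finset.card_image_of_injective _ hf', Finset.card_univ, Fintype.card_fin]⟩
    have hfS : ∀ i, (f i).1 ∈ S.1 := fun i => Finset.mem_image_of_mem _ (Finset.mem_univ i)
    let τ : Fin k → Fin k := fun i => (S.1.orderIsoOfFin S.2).symm ⟨(f i).1, hfS i⟩
    have hτ : ∀ i, rowEnum S (τ i) = (f i).1 := fun i => by simp [rowEnum, τ]
    have hτi : Function.Injective τ := fun a b hab => hf' (by simp only [← hτ, hab])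
    refine ⟨(S, Equiv.ofBijective τ (Finite.injective_iff_bijective.1 hτi)), ?_, ?_⟩
    · refine Finset.mem_product.2 ⟨Finset.mem_filter.2 ⟨Finset.mem_univ _, ?_⟩, Finset.mem_univ _⟩
      exact Finset.image_subset_iff.2 fun i _ => (f i).2
    · exact funext fun i => Subtype.ext (hτ i)
  · rintro ⟨S, σ⟩ hp
    rfl

theorem Vlow_mul_transpose_add_Vhigh_mul_transpose {d k : ℕ} (hkd : k ≤ d)
    {V : Matrix (Fin d) (Fin d) ℝ} (hV : Vᵀ * V = 1) (S : {S : Finset (Fin d) // S.card = k}) :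
    Vlow V hkd S * (Vlow V hkd S)ᵀ + Vhigh V hkd S * (Vhigh V hkd S)ᵀ = 1 := by
  have hinj : Function.Injective (rowEnum S) :=
    Subtype.val_injective.comp (S.1.orderIsoOfFin S.2).injective
  have h : V * Vᵀ = 1 := mul_eq_one_comm.1 hV
  ext a b
  have hab := congrFun (congrFun h (rowEnum S a)) (rowEnum S b)
  rw [mul_apply] at hab
  obtain ⟨m, rfl⟩ := Nat.exists_eq_add_of_le hkd
  have e : (1 : Matrix (Fin k) (Fin k) ℝ) a b =
      (1 : Matrix (Fin (k + m)) (Fin (k + m)) ℝ) (rowEnum S a) (rowEnum S b) := by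
    simp [one_apply, hinj.eq_iff]
  rw [e, ← hab, Fin.sum_univ_add, Matrix.add_apply, mul_apply, mul_apply]
  congr 1
  refine Fintype.sum_equiv (finCongr (by omega)) _ _ fun j => ?_
  rfl

theorem det_sq_mul_trace_ZS {d k : ℕ} (hkd : k ≤ d) {V : Matrix (Fin d) (Fin d) ℝ}
    (hV : Vᵀ * V = 1) (S : {S : Finset (Fin d) // S.card = k}) (hS : (Vlow V hkd S).det ≠ 0) :
    (Vlow V hkd S).det ^ 2 * (ZS V hkd S * (ZS V hkd S)ᵀ).trace =
      ∑ j, ∑ i, (Vlow V hkd S).adjugate j i ^ 2 - k * (Vlow V hkd S).det ^ 2 := by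
  have h := Vlow_mul_transpose_add_Vhigh_mul_transpose hkd hV S
  unfold ZS
  set L := Vlow V hkd S
  set H := Vhigh V hkd S
  have hL : IsUnit L.det := isUnit_iff_ne_zero.2 hS
  have hL' : IsUnit Lᵀ.det := by rwa [det_transpose]
  have h1 : (Hᵀ * Lᵀ⁻¹ * (Hᵀ * Lᵀ⁻¹)ᵀ).trace = (L⁻¹ᵀ * L⁻¹).trace - k := by
    have e : Hᵀ * Lᵀ⁻¹ * (Hᵀ * Lᵀ⁻¹)ᵀ = Hᵀ * (Lᵀ⁻¹ * L⁻¹ * H) := by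
      rw [transpose_mul, transpose_transpose, transpose_nonsing_inv, transpose_transpose]
      simp only [Matrix.mul_assoc]
    rw [e, trace_mul_comm, Matrix.mul_assoc, eq_sub_of_add_eq' h, mul_sub, mul_one, trace_sub,
      transpose_nonsing_inv, mul_assoc Lᵀ⁻¹, nonsing_inv_mul_cancel_left _ _ hL,
      nonsing_inv_mul _ hL', trace_one, Fintype.card_fin]
  have h2 : L.det ^ 2 * (L⁻¹ᵀ * L⁻¹).trace = ∑ j, ∑ i, L.adjugate j i ^ 2 := by
    have h3 : L.adjugate = L.det • L⁻¹ := by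
      rw [inv_def, smul_smul, Ring.mul_inverse_cancel _ hL, one_smul]
    rw [h3, trace, Finset.mul_sum, Finset.sum_comm]
    refine Finset.sum_congr rfl fun i _ => ?_
    rw [diag_apply, mul_apply, Finset.mul_sum]
    refine Finset.sum_congr rfl fun j _ => ?_
    rw [transpose_apply, Matrix.smul_apply, smul_eq_mul]
    ring
  rw [h1, mul_sub, h2]
  ring

open scoped Classical in
theorem dpp_conditional_sum_tan_sq_bound {d k : ℕ} (hk : 1 ≤ k) (hkd : k < d)
    (V : Matrix (Fin d) (Fin d) ℝ) (hV : Vᵀ * V = 1)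
    (θ : ℝ) (hθ : 1 < θ) (π : Equiv.Perm (Fin d))
    (hπ : ∀ i j : Fin d, i ≤ j → lev V k hkd.le (π j) ≤ lev V k hkd.le (π i))
    (q : ℕ) (hkq : k ≤ q) (hqd : q ≤ d)
    (hq : (k : ℝ) - 1 + 1 / θ ≤
      ∑ i ∈ Finset.univ.filter (fun i : Fin d => (i : ℕ) < q), lev V k hkd.le (π i)) :
    ∑ S ∈ Finset.univ.filter
        (fun S : {S : Finset (Fin d) // S.card = k} =>
          S.1 ⊆ (Finset.univ.filter (fun i : Fin d => (i : ℕ) < q)).image π ∧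
            (Vlow V hkd.le S).det ≠ 0),
      (Vlow V hkd.le S).det ^ 2 * Matrix.trace (ZS V hkd.le S * (ZS V hkd.le S)ᵀ) ≤
    (((q : ℝ) - (k : ℝ) + 1) * ((k : ℝ) - 1 + θ) - (k : ℝ)) *
      ∑ S ∈ Finset.univ.filter
          (fun S : {S : Finset (Fin d) // S.card = k} =>
            S.1 ⊆ (Finset.univ.filter (fun i : Fin d => (i : ℕ) < q)).image π),
        (Vlow V hkd.le S).det ^ 2 := by
  set Q : Finset (Fin d) := (Finset.univ.filter (fun i : Fin d => (i : ℕ) < q)).image π with hQ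
  have hcard : Fintype.card Q = q := by
    rw [Fintype.card_coe, hQ, Finset.card_image_of_injective _ π.injective, Fin.card_filter_val_lt,
      min_eq_right hqd]
  have : Nonempty (Fin k) := ⟨⟨0, hk⟩⟩
  have hkq' : Fintype.card (Fin k) ≤ Fintype.card Q := by rwa [hcard, Fintype.card_fin]
  set W : Matrix (Fin d) (Fin k) ℝ := V.submatrix id (Fin.castLE hkd.le) with hW
  set A : Matrix Q (Fin k) ℝ := W.submatrix (fun x => x.1) id with hA
  have hfac : (k.factorial : ℝ) ≠ 0 := Nat.cast_ne_zero.2 k.factorial_ne_zero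
  have hdet : ∑ S : {S : Finset (Fin d) // S.card = k} with S.1 ⊆ Q, (Vlow V hkd.le S).det ^ 2 =
      (Aᵀ * A).det := by
    have h1 := sum_injective_det_sq A
    have h2 := sum_injective_eq_factorial_mul_sum Q (fun f => (W.submatrix f id).det ^ 2)
      fun f σ => by
        have := det_permute σ (W.submatrix f id)
        rw [submatrix_submatrix] at this
        rw [← Function.id_comp (id : Fin k → Fin k), this, mul_pow]
        rcases Int.units_eq_one_or (Equiv.Perm.sign σ) with h | h <;> simp [h]
    rw [Fintype.card_fin] at h1
    exact mul_left_cancel₀ hfac (h2.symm.trans (by convert h1; rfl))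
  have hadj : ∑ S : {S : Finset (Fin d) // S.card = k} with S.1 ⊆ Q,
      ∑ j, ∑ i, (Vlow V hkd.le S).adjugate j i ^ 2 =
        (q - k + 1 : ℝ) * (Aᵀ * A).adjugate.trace := by
    have h1 := sum_injective_adjugate_sq A hkq'
    have h2 := sum_injective_eq_factorial_mul_sum Q
      (fun f => ∑ j, ∑ i, (W.submatrix f id).adjugate j i ^ 2) fun f σ => by
        refine Finset.sum_congr rfl fun j _ => ?_
        refine Fintype.sum_equiv σ _ _ fun i => ?_
        rw [adjugate_apply, adjugate_apply]
        have := det_permute σ ((W.submatrix f id).updateRow (σ i) (Pi.single j 1))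
        have e : (W.submatrix (f ∘ σ) id).updateRow i (Pi.single j 1) =
            ((W.submatrix f id).updateRow (σ i) (Pi.single j 1)).submatrix σ id := by
          ext a b
          simp [updateRow_apply]
        rw [e, this, mul_pow]
        rcases Int.units_eq_one_or (Equiv.Perm.sign σ) with h | h <;> simp [h]
    rw [Fintype.card_fin, hcard] at h1
    exact mul_left_cancel₀ hfac (h2.symm.trans (by convert h1; rfl))
  have hpsd : (Aᵀ * A).PosSemidef := posSemidef_conjTranspose_mul_self A
  have hcompl : (1 - Aᵀ * A).PosSemidef := by
    set B : Matrix {x // x ∉ Q} (Fin k) ℝ := W.submatrix (fun x => x.1) id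
    have hWW : Wᵀ * W = 1 := by
      rw [hW, transpose_submatrix, ← submatrix_mul _ _ _ _ _ Function.bijective_id, hV,
        submatrix_one _ (Fin.castLE_injective _)]
    have : 1 - Aᵀ * A = Bᵀ * B := by
      rw [sub_eq_iff_eq_add, ← hWW]
      ext a b
      simp only [Matrix.add_apply, mul_apply, transpose_apply]
      rw [add_comm]
      convert (Fintype.sum_subtype_add_sum_subtype (· ∈ Q) fun x => W x a * W x b).symm <;> rfl
    rw [this]
    exact posSemidef_conjTranspose_mul_self B
  have htr : (Fintype.card (Fin k) : ℝ) - 1 + 1 / θ ≤ (Aᵀ * A).trace := by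
    rw [Fintype.card_fin]
    refine hq.trans_eq ?_
    rw [← Finset.sum_image (f := lev V k hkd.le) (g := π) fun a _ b _ h => π.injective h, ← hQ,
      ← Finset.sum_coe_sort, trace_mul_comm, trace]
    refine Finset.sum_congr rfl fun x _ => ?_
    simp [lev, hA, hW, mul_apply, sq]
  have hbound := trace_adjugate_le hpsd hcompl (zero_lt_one.trans hθ) htr
  rw [Fintype.card_fin] at hbound
  have hq0 : (0 : ℝ) ≤ q - k + 1 := by
    have : (k : ℝ) ≤ q := Nat.cast_le.2 hkq
    linarith
  calc _ = ∑ S : {S : Finset (Fin d) // S.card = k} with S.1 ⊆ Q ∧ (Vlow V hkd.le S).det ≠ 0,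
        (∑ j, ∑ i, (Vlow V hkd.le S).adjugate j i ^ 2 - k * (Vlow V hkd.le S).det ^ 2) :=
        Finset.sum_congr rfl fun S hS =>
          det_sq_mul_trace_ZS hkd.le hV S (Finset.mem_filter.1 hS).2.2
    _ ≤ ∑ S : {S : Finset (Fin d) // S.card = k} with S.1 ⊆ Q,
        (∑ j, ∑ i, (Vlow V hkd.le S).adjugate j i ^ 2 - k * (Vlow V hkd.le S).det ^ 2) := by
        refine Finset.sum_le_sum_of_subset_of_nonneg
          (Finset.monotone_filter_right _ fun S _ h => h.1) fun S hS hS' => ?_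
        have h0 : (Vlow V hkd.le S).det = 0 := by
          by_contra h
          exact hS' (Finset.mem_filter.2 ⟨Finset.mem_univ _, (Finset.mem_filter.1 hS).2, h⟩)
        rw [h0]
        simp only [ne_eq, OfNat.ofNat_ne_zero, not_false_eq_true, zero_pow, mul_zero, sub_zero]
        positivity
    _ = (q - k + 1 : ℝ) * (Aᵀ * A).adjugate.trace - k * (Aᵀ * A).det := by
        rw [Finset.sum_sub_distrib, ← Finset.mul_sum, hadj, hdet]
    _ ≤ _ := by
        rw [hdet]
        linarith [mul_le_mul_of_nonneg_left hbound hq0]
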